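/- Equivalence with the original axiomatization: For any set Γ ∪ {φ} of L⁺-sentences, Γ ⊢ φ (in NBQL_CD^r) if and only if Γ ⊢_{TJK^{d+}} φ (in the original axiomatization of TJK^{d+}). -/

import Mathlib

universe u v

namespace BQL

structure Signature : Type 1 where
  Const : Type
  Func : Type
  arityF : Func → ℕ
  Rel : Type
  arityR : Rel → ℕ

inductive Term (L : Signature) : Type
  | var : ℕ → Term L
  | const : L.Const → Term L
  | func : (f : L.Func) → (Fin (L.arityF f) → Term L) → Term L

inductive Formula (L : Signature) : Type
  | top : Formula L
  | bot : Formula L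
  | rel : (R : L.Rel) → (Fin (L.arityR R) → Term L) → Formula L
  | and : Formula L → Formula L → Formula L
  | or : Formula L → Formula L → Formula L
  | imp : Formula L → Formula L → Formula L
  | all : Formula L → Formula L
  | ex : Formula L → Formula L

variable {L : Signature}

namespace Term

/-- Shift all (free) variables of a term up by one. -/
def shiftUp : Term L → Term L
  | var n => var (n + 1)
  | const c => const c
  | func f ts => func f fun i => (ts i).shiftUp

/-- Apply a simultaneous substitution to a term. -/
def applySub (σ : ℕ → Term L) : Term L → Term L
  | var n => σ n
  | const c => const c
  | func f ts => func f fun i => (ts i).applySub σ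

/-- All variables of the term are `< k`. -/
def ClosedAt : Term L → ℕ → Prop
  | var n, k => n < k
  | const _, _ => True
  | func _ ts, k => ∀ i, (ts i).ClosedAt k

/-- A closed term. -/
def Closed (t : Term L) : Prop := t.ClosedAt 0

/-- The constant `c` occurs in the term. -/
def OccC (c : L.Const) : Term L → Prop
  | var _ => False
  | const d => d = c
  | func _ ts => ∃ i, (ts i).OccC c

end Term

/-- Lift a substitution under a binder. -/
def liftSub (σ : ℕ → Term L) : ℕ → Term L
  | 0 => .var 0
  | n + 1 => (σ n).shiftUp

namespace Formula

/-- Apply a simultaneous substitution to a formula. -/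
def applySub (σ : ℕ → Term L) : Formula L → Formula L
  | top => top
  | bot => bot
  | rel R ts => rel R fun i => (ts i).applySub σ
  | and φ ψ => and (φ.applySub σ) (ψ.applySub σ)
  | or φ ψ => or (φ.applySub σ) (ψ.applySub σ)
  | imp φ ψ => imp (φ.applySub σ) (ψ.applySub σ)
  | all φ => all (φ.applySub (liftSub σ))
  | ex φ => ex (φ.applySub (liftSub σ))

/-- All free variables of the formula are `< k`. -/
def ClosedAt : Formula L → ℕ → Prop
  | top, _ => True
  | bot, _ => True
  | rel _ ts, k => ∀ i, (ts i).ClosedAt k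
  | and φ ψ, k => φ.ClosedAt k ∧ ψ.ClosedAt k
  | or φ ψ, k => φ.ClosedAt k ∧ ψ.ClosedAt k
  | imp φ ψ, k => φ.ClosedAt k ∧ ψ.ClosedAt k
  | all φ, k => φ.ClosedAt (k + 1)
  | ex φ, k => φ.ClosedAt (k + 1)

/-- A sentence: a formula with no free variables. -/
def Sentence (φ : Formula L) : Prop := φ.ClosedAt 0

/-- The constant `c` occurs in the formula. -/
def OccC (c : L.Const) : Formula L → Prop
  | top => False
  | bot => False
  | rel _ ts => ∃ i, (ts i).OccC c
  | and φ ψ => φ.OccC c ∨ ψ.OccC c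
  | or φ ψ => φ.OccC c ∨ ψ.OccC c
  | imp φ ψ => φ.OccC c ∨ ψ.OccC c
  | all φ => φ.OccC c
  | ex φ => φ.OccC c

/-- The formula contains no occurrence of `∨` and no occurrence of `∃`. -/
def NoOrEx : Formula L → Prop
  | top => True
  | bot => True
  | rel _ _ => True
  | and φ ψ => φ.NoOrEx ∧ ψ.NoOrEx
  | or _ _ => False
  | imp φ ψ => φ.NoOrEx ∧ ψ.NoOrEx
  | all φ => φ.NoOrEx
  | ex _ => False

end Formula

/-- Substitute the term `t` for the variable `v₀` (lowering the other variables). -/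
def subst0 (φ : Formula L) (t : Term L) : Formula L :=
  φ.applySub fun n => match n with | 0 => t | n + 1 => .var n

/-- `□ⁿφ`, where `□φ` abbreviates `⊤ → φ`. -/
def boxN : ℕ → Formula L → Formula L
  | 0, φ => φ
  | n + 1, φ => .imp .top (boxN n φ)

/-- The conjunction of a finite list of formulas (`⋀∅ = ⊤`). -/
def conjL : List (Formula L) → Formula L
  | [] => .top
  | [φ] => φ
  | φ :: ψ :: l => .and φ (conjL (ψ :: l))

/-- The language `L⁺`, obtained from `L` by adding countably many fresh constants `aᵢ`. -/
def Signature.plus (L : Signature) : Signature where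
  Const := L.Const ⊕ ℕ
  Func := L.Func
  arityF := L.arityF
  Rel := L.Rel
  arityR := L.arityR

/-- The fresh constant `aᵢ` of `L⁺`. -/
def aconst (L : Signature) (i : ℕ) : Term L.plus := .const (Sum.inr i)

/-- Embedding of `L`-terms into `L⁺`-terms. -/
def Term.emb : Term L → Term L.plus
  | .var n => .var n
  | .const c => .const (Sum.inl c)
  | .func f ts => .func f fun i => (ts i).emb

/-- Embedding of `L`-formulas into `L⁺`-formulas. -/
def Formula.emb : Formula L → Formula L.plus
  | .top => .top
  | .bot => .bot
  | .rel R ts => .rel R fun i => (ts i).emb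
  | .and φ ψ => .and φ.emb ψ.emb
  | .or φ ψ => .or φ.emb ψ.emb
  | .imp φ ψ => .imp φ.emb ψ.emb
  | .all φ => .all φ.emb
  | .ex φ => .ex φ.emb

/-- The fresh constant `aᵢ` occurs in no member of `Γ`. -/
def FreshIn (i : ℕ) (Γ : Set (Formula L.plus)) : Prop :=
  ∀ ψ ∈ Γ, ¬ ψ.OccC (Sum.inr i)

/-- A Kripke `L`-model (the frame conditions are packaged in `KModel.Proper`). -/
structure KModel (L : Signature) : Type (u + 1) where
  W : Type u
  acc : W → W → Prop
  D : Type u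
  interpC : L.Const → D
  interpF : (f : L.Func) → (Fin (L.arityF f) → D) → D
  interpR : (R : L.Rel) → W → Set (Fin (L.arityR R) → D)

/-- The conditions on an `L`-model: nonempty set of worlds, transitive accessibility
relation, nonempty domain, and the persistence constraint. -/
def KModel.Proper (M : KModel.{u} L) : Prop :=
  Nonempty M.W ∧ Nonempty M.D ∧ Transitive M.acc ∧
    ∀ (R : L.Rel) (w u' : M.W), M.acc w u' → M.interpR R w ⊆ M.interpR R u'

/-- Prepend a value to a valuation. -/
def vcons {α : Sort*} (d : α) (ρ : ℕ → α) : ℕ → α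
  | 0 => d
  | n + 1 => ρ n

/-- Denotation of a term. -/
def Term.eval (M : KModel.{u} L) (ρ : ℕ → M.D) : Term L → M.D
  | .var n => ρ n
  | .const c => M.interpC c
  | .func f ts => M.interpF f fun i => (ts i).eval M ρ

/-- The satisfaction relation `w ⊩ φ(ā)`. -/
def Sat (M : KModel.{u} L) : M.W → (ℕ → M.D) → Formula L → Prop
  | _, _, .top => True
  | _, _, .bot => False
  | w, ρ, .rel R ts => (fun i => (ts i).eval M ρ) ∈ M.interpR R w
  | w, ρ, .and φ ψ => Sat M w ρ φ ∧ Sat M w ρ ψ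
  | w, ρ, .or φ ψ => Sat M w ρ φ ∨ Sat M w ρ ψ
  | w, ρ, .imp φ ψ => ∀ u', M.acc w u' → Sat M u' ρ φ → Sat M u' ρ ψ
  | w, ρ, .all φ => ∀ d, Sat M w (vcons d ρ) φ
  | w, ρ, .ex φ => ∃ d, Sat M w (vcons d ρ) φ

/-- Satisfaction of a sentence (under every valuation). -/
def SatS (M : KModel.{u} L) (w : M.W) (φ : Formula L) : Prop := ∀ ρ, Sat M w ρ φ

/-- `Γ ⊨ φ`: truth is preserved at every reflexive world of every `L`-model. -/
def Models (Γ : Set (Formula L)) (φ : Formula L) : Prop :=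
  ∀ M : KModel.{u} L, M.Proper → ∀ w : M.W, M.acc w w →
    (∀ ψ ∈ Γ, SatS M w ψ) → SatS M w φ

/-- `Γ : Δ ⊨ φ`: for every `L`-model, every reflexive world `w` and every world `u ≻ w`:
if `w ⊩ Γ` and `u ⊩ Δ` then `u ⊩ φ`. -/
def ModelsCtx (Γ Δ : Set (Formula L)) (φ : Formula L) : Prop :=
  ∀ M : KModel.{u} L, M.Proper → ∀ w u' : M.W, M.acc w w → M.acc w u' →
    (∀ ψ ∈ Γ, SatS M w ψ) → (∀ ψ ∈ Δ, SatS M u' ψ) → SatS M u' φ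

end BQL

namespace BQL

/-- `Prf L Γ Δ φ` formalizes `Γ : Δ ⊢ φ`: there is a proof of `φ` in the natural
deduction system `NBQL_CD^r` (over `L⁺`-sentences) whose open assumptions all belong
to `Γ ∪ Δ` and in which every open assumption occurring *unsafely* (i.e. in the right
main subproof of an application of `→`-Elim) belongs to `Γ`.  Assumptions may be
discharged only at safe occurrences, so discharge always happens in the `Δ` zone. -/
inductive Prf (L : Signature) :
    Set (Formula L.plus) → Set (Formula L.plus) → Formula L.plus → Prop
  | hyp {Γ Δ : Set (Formula L.plus)} {φ} : φ ∈ Γ ∪ Δ → φ.Sentence → Prf L Γ Δ φ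
  | weaken {Γ Γ' Δ Δ' φ} : Γ ⊆ Γ' → Δ ⊆ Δ' → Prf L Γ Δ φ → Prf L Γ' Δ' φ
  | topIntro {Γ Δ} : Prf L Γ Δ .top
  | botElim {Γ Δ φ} : φ.Sentence → Prf L Γ Δ .bot → Prf L Γ Δ φ
  | andIntro {Γ Δ φ ψ} : Prf L Γ Δ φ → Prf L Γ Δ ψ → Prf L Γ Δ (.and φ ψ)
  | andElimL {Γ Δ φ ψ} : Prf L Γ Δ (.and φ ψ) → Prf L Γ Δ φ
  | andElimR {Γ Δ φ ψ} : Prf L Γ Δ (.and φ ψ) → Prf L Γ Δ ψ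
  | orIntroL {Γ Δ φ ψ} : ψ.Sentence → Prf L Γ Δ φ → Prf L Γ Δ (.or φ ψ)
  | orIntroR {Γ Δ φ ψ} : φ.Sentence → Prf L Γ Δ ψ → Prf L Γ Δ (.or φ ψ)
  | orElim {Γ Δ φ ψ χ} : Prf L Γ Δ (.or φ ψ) → Prf L Γ (insert φ Δ) χ →
      Prf L Γ (insert ψ Δ) χ → Prf L Γ Δ χ
  | impIntro {Γ Δ φ ψ} : φ.Sentence → Prf L Γ (insert φ Δ) ψ → Prf L Γ Δ (.imp φ ψ)
  | impElim {Γ Δ φ ψ} : Prf L Γ Δ φ → Prf L Γ ∅ (.imp φ ψ) → Prf L Γ Δ ψ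
  | intTrans {Γ Δ φ ψ χ} : Prf L Γ Δ (.imp φ ψ) → Prf L Γ Δ (.imp ψ χ) →
      Prf L Γ Δ (.imp φ χ)
  | intAndIntro {Γ Δ φ ψ χ} : Prf L Γ Δ (.imp φ ψ) → Prf L Γ Δ (.imp φ χ) →
      Prf L Γ Δ (.imp φ (.and ψ χ))
  | intOrElim {Γ Δ φ ψ χ} : Prf L Γ Δ (.imp φ χ) → Prf L Γ Δ (.imp ψ χ) →
      Prf L Γ Δ (.imp (.or φ ψ) χ)
  | intAllIntro {Γ Δ φ ψ} : φ.Sentence → Prf L Γ Δ (.all (.imp φ ψ)) →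
      Prf L Γ Δ (.imp φ (.all ψ))
  | intExElim {Γ Δ φ ψ} : ψ.Sentence → Prf L Γ Δ (.all (.imp φ ψ)) →
      Prf L Γ Δ (.imp (.ex φ) ψ)
  | allIntro {Γ Δ Γ' Δ' φ} {i : ℕ} : Γ' ⊆ Γ → Δ' ⊆ Δ → FreshIn i Γ' → FreshIn i Δ' →
      ¬ φ.OccC (Sum.inr i) → Prf L Γ' Δ' (subst0 φ (aconst L i)) → Prf L Γ Δ (.all φ)
  | allElim {Γ Δ φ} {t : Term L.plus} : t.Closed → Prf L Γ Δ (.all φ) →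
      Prf L Γ Δ (subst0 φ t)
  | cd {Γ Δ φ ψ} : φ.Sentence → Prf L Γ Δ (.all (.or φ ψ)) → Prf L Γ Δ (.or φ (.all ψ))
  | exIntro {Γ Δ φ} {t : Term L.plus} : t.Closed → (Formula.ex φ).Sentence →
      Prf L Γ Δ (subst0 φ t) → Prf L Γ Δ (.ex φ)
  | exElim {Γ Δ Γ' Δ' φ ψ} {i : ℕ} : Γ' ⊆ Γ → Δ' ⊆ Δ → FreshIn i Γ' → FreshIn i Δ' →
      ¬ φ.OccC (Sum.inr i) → ¬ ψ.OccC (Sum.inr i) → Prf L Γ Δ (.ex φ) →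
      Prf L Γ' (insert (subst0 φ (aconst L i)) Δ') ψ → Prf L Γ Δ ψ

/-- `Γ ⊢ φ`: there is a proof of `φ` from `Γ` in `NBQL_CD^r`. -/
def Prv (L : Signature) (Γ : Set (Formula L.plus)) (φ : Formula L.plus) : Prop :=
  Prf L Γ ∅ φ

end BQL

namespace BQL

/-- The axiom schemas of the original axiomatization of `TJK^{d+}` (the axioms of
`B^{d+}` together with transitivity, weakening, prefixing and suffixing). -/
inductive TJKAx (L : Signature) : Formula L.plus → Prop
  | id {φ} : φ.Sentence → TJKAx L (.imp φ φ)
  | toTop {φ} : φ.Sentence → TJKAx L (.imp φ .top)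
  | fromBot {φ} : φ.Sentence → TJKAx L (.imp .bot φ)
  | andComp {φ ψ χ} : φ.Sentence → ψ.Sentence → χ.Sentence →
      TJKAx L (.imp (.and (.imp χ φ) (.imp χ ψ)) (.imp χ (.and φ ψ)))
  | andElimL {φ ψ} : φ.Sentence → ψ.Sentence → TJKAx L (.imp (.and φ ψ) φ)
  | andElimR {φ ψ} : φ.Sentence → ψ.Sentence → TJKAx L (.imp (.and φ ψ) ψ)
  | orIntroL {φ ψ} : φ.Sentence → ψ.Sentence → TJKAx L (.imp φ (.or φ ψ))
  | orIntroR {φ ψ} : φ.Sentence → ψ.Sentence → TJKAx L (.imp ψ (.or φ ψ))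
  | orComp {φ ψ χ} : φ.Sentence → ψ.Sentence → χ.Sentence →
      TJKAx L (.imp (.and (.imp φ χ) (.imp ψ χ)) (.imp (.or φ ψ) χ))
  | distrib {φ ψ χ} : φ.Sentence → ψ.Sentence → χ.Sentence →
      TJKAx L (.imp (.and φ (.or ψ χ)) (.or (.and φ ψ) (.and φ χ)))
  | allImp {φ ψ} : φ.Sentence → ψ.ClosedAt 1 →
      TJKAx L (.imp (.all (.imp φ ψ)) (.imp φ (.all ψ)))
  | allElim {φ} {t : Term L.plus} : φ.ClosedAt 1 → t.Closed →
      TJKAx L (.imp (.all φ) (subst0 φ t))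
  | exIntro {φ} {t : Term L.plus} : φ.ClosedAt 1 → t.Closed →
      TJKAx L (.imp (subst0 φ t) (.ex φ))
  | exImp {φ ψ} : φ.ClosedAt 1 → ψ.Sentence →
      TJKAx L (.imp (.all (.imp φ ψ)) (.imp (.ex φ) ψ))
  | cd {φ ψ} : φ.Sentence → ψ.ClosedAt 1 →
      TJKAx L (.imp (.all (.or φ ψ)) (.or φ (.all ψ)))
  | exDistrib {φ ψ} : φ.Sentence → ψ.ClosedAt 1 →
      TJKAx L (.imp (.and φ (.ex ψ)) (.ex (.and φ ψ)))
  | trans {φ ψ χ} : φ.Sentence → ψ.Sentence → χ.Sentence →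
      TJKAx L (.imp (.and (.imp φ ψ) (.imp ψ χ)) (.imp φ χ))
  | weakK {φ ψ} : φ.Sentence → ψ.Sentence → TJKAx L (.imp φ (.imp ψ φ))
  | prefixing {φ ψ χ} : φ.Sentence → ψ.Sentence → χ.Sentence →
      TJKAx L (.imp (.imp φ ψ) (.imp (.imp χ φ) (.imp χ ψ)))
  | suffixing {φ ψ χ} : φ.Sentence → ψ.Sentence → χ.Sentence →
      TJKAx L (.imp (.imp φ ψ) (.imp (.imp ψ χ) (.imp φ χ)))

/-- `Γ ⊢_{TJK^{d+}} φ`: derivability in the original axiomatization of `TJK^{d+}`. -/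
inductive TJKd (L : Signature) : Set (Formula L.plus) → Formula L.plus → Prop
  | hyp {Γ φ} : φ ∈ Γ → φ.Sentence → TJKd L Γ φ
  | weaken {Γ Γ' φ} : Γ ⊆ Γ' → TJKd L Γ φ → TJKd L Γ' φ
  | ax {Γ φ} : TJKAx L φ → TJKd L Γ φ
  | topIntro {Γ} : TJKd L Γ .top
  | botElim {Γ φ} : φ.Sentence → TJKd L Γ .bot → TJKd L Γ φ
  | andIntro {Γ φ ψ} : TJKd L Γ φ → TJKd L Γ ψ → TJKd L Γ (.and φ ψ)
  | andElimL {Γ φ ψ} : TJKd L Γ (.and φ ψ) → TJKd L Γ φ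
  | andElimR {Γ φ ψ} : TJKd L Γ (.and φ ψ) → TJKd L Γ ψ
  | orIntroL {Γ φ ψ} : ψ.Sentence → TJKd L Γ φ → TJKd L Γ (.or φ ψ)
  | orIntroR {Γ φ ψ} : φ.Sentence → TJKd L Γ ψ → TJKd L Γ (.or φ ψ)
  | orElim {Γ φ ψ χ} : TJKd L Γ (.or φ ψ) → TJKd L (insert φ Γ) χ →
      TJKd L (insert ψ Γ) χ → TJKd L Γ χ
  | impElim {Γ φ ψ} : TJKd L Γ φ → TJKd L Γ (.imp φ ψ) → TJKd L Γ ψ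
  | affix {Γ φ ψ χ γ} : TJKd L Γ (.imp φ ψ) → TJKd L Γ (.imp χ γ) →
      TJKd L Γ (.imp (.imp ψ χ) (.imp φ γ))
  | allIntro {Γ Γ' φ} {i : ℕ} : Γ' ⊆ Γ → FreshIn i Γ' → ¬ φ.OccC (Sum.inr i) →
      TJKd L Γ' (subst0 φ (aconst L i)) → TJKd L Γ (.all φ)
  | allElim {Γ φ} {t : Term L.plus} : t.Closed → TJKd L Γ (.all φ) →
      TJKd L Γ (subst0 φ t)
  | cd {Γ φ ψ} : φ.Sentence → TJKd L Γ (.all (.or φ ψ)) → TJKd L Γ (.or φ (.all ψ))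
  | exIntro {Γ φ} {t : Term L.plus} : t.Closed → (Formula.ex φ).Sentence →
      TJKd L Γ (subst0 φ t) → TJKd L Γ (.ex φ)
  | exElim {Γ Γ' φ ψ} {i : ℕ} : Γ' ⊆ Γ → FreshIn i Γ' → ¬ φ.OccC (Sum.inr i) →
      ¬ ψ.OccC (Sum.inr i) → TJKd L Γ (.ex φ) →
      TJKd L (insert (subst0 φ (aconst L i)) Γ') ψ → TJKd L Γ ψ

/-- `Γ ⊢_{TJK⁺} φ`: derivability in `TJK⁺`, i.e. `TJK^{d+}` without the `∃`-Elim rule. -/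
inductive TJKp (L : Signature) : Set (Formula L.plus) → Formula L.plus → Prop
  | hyp {Γ φ} : φ ∈ Γ → φ.Sentence → TJKp L Γ φ
  | weaken {Γ Γ' φ} : Γ ⊆ Γ' → TJKp L Γ φ → TJKp L Γ' φ
  | ax {Γ φ} : TJKAx L φ → TJKp L Γ φ
  | topIntro {Γ} : TJKp L Γ .top
  | botElim {Γ φ} : φ.Sentence → TJKp L Γ .bot → TJKp L Γ φ
  | andIntro {Γ φ ψ} : TJKp L Γ φ → TJKp L Γ ψ → TJKp L Γ (.and φ ψ)
  | andElimL {Γ φ ψ} : TJKp L Γ (.and φ ψ) → TJKp L Γ φ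
  | andElimR {Γ φ ψ} : TJKp L Γ (.and φ ψ) → TJKp L Γ ψ
  | orIntroL {Γ φ ψ} : ψ.Sentence → TJKp L Γ φ → TJKp L Γ (.or φ ψ)
  | orIntroR {Γ φ ψ} : φ.Sentence → TJKp L Γ ψ → TJKp L Γ (.or φ ψ)
  | orElim {Γ φ ψ χ} : TJKp L Γ (.or φ ψ) → TJKp L (insert φ Γ) χ →
      TJKp L (insert ψ Γ) χ → TJKp L Γ χ
  | impElim {Γ φ ψ} : TJKp L Γ φ → TJKp L Γ (.imp φ ψ) → TJKp L Γ ψ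
  | affix {Γ φ ψ χ γ} : TJKp L Γ (.imp φ ψ) → TJKp L Γ (.imp χ γ) →
      TJKp L Γ (.imp (.imp ψ χ) (.imp φ γ))
  | allIntro {Γ Γ' φ} {i : ℕ} : Γ' ⊆ Γ → FreshIn i Γ' → ¬ φ.OccC (Sum.inr i) →
      TJKp L Γ' (subst0 φ (aconst L i)) → TJKp L Γ (.all φ)
  | allElim {Γ φ} {t : Term L.plus} : t.Closed → TJKp L Γ (.all φ) →
      TJKp L Γ (subst0 φ t)
  | cd {Γ φ ψ} : φ.Sentence → TJKp L Γ (.all (.or φ ψ)) → TJKp L Γ (.or φ (.all ψ))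
  | exIntro {Γ φ} {t : Term L.plus} : t.Closed → (Formula.ex φ).Sentence →
      TJKp L Γ (subst0 φ t) → TJKp L Γ (.ex φ)

end BQL

namespace BQL

variable {L : Signature}

namespace Term

theorem applySub_eq_self {σ : ℕ → Term L} {k : ℕ} (hσ : ∀ n < k, σ n = .var n) :
    ∀ {t : Term L}, t.ClosedAt k → t.applySub σ = t
  | var n, h => hσ n h
  | const _, _ => rfl
  | func f ts, h => by
    simp only [applySub]
    exact congrArg _ (funext fun i => applySub_eq_self hσ (h i))

theorem closedAt_shiftUp {m : ℕ} : ∀ {t : Term L}, t.shiftUp.ClosedAt (m + 1) ↔ t.ClosedAt m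
  | var n => by simp [shiftUp, ClosedAt]
  | const _ => Iff.rfl
  | func f ts => forall_congr' fun i => closedAt_shiftUp (t := ts i)

theorem ClosedAt.applySub {σ : ℕ → Term L} {k m : ℕ} (hσ : ∀ n < k, (σ n).ClosedAt m) :
    ∀ {t : Term L}, t.ClosedAt k → (t.applySub σ).ClosedAt m
  | var n, h => hσ n h
  | const _, _ => trivial
  | func _ _, h => fun i => ClosedAt.applySub hσ (h i)

theorem ClosedAt.of_applySub {σ : ℕ → Term L} {k m : ℕ}
    (hσ : ∀ n, (σ n).ClosedAt m → n < k) :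
    ∀ {t : Term L}, (t.applySub σ).ClosedAt m → t.ClosedAt k
  | var n, h => hσ n h
  | const _, _ => trivial
  | func _ _, h => fun i => ClosedAt.of_applySub hσ (h i)

theorem exists_fresh_bound :
    ∀ t : Term L.plus, ∃ N : ℕ, ∀ i ≥ N, ¬ t.OccC (Sum.inr i : L.plus.Const)
  | var _ => ⟨0, fun _ _ h => h⟩
  | const (Sum.inl c) => ⟨0, fun _ _ h => by cases (show Sum.inl c = Sum.inr _ from h)⟩
  | const (Sum.inr j) => ⟨j + 1, fun i hi h => by
      cases (show (Sum.inr j : L.Const ⊕ ℕ) = Sum.inr i from h)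
      omega⟩
  | func f ts => by
    choose N hN using fun i => exists_fresh_bound (ts i)
    exact ⟨Finset.univ.sup N, fun i hi ⟨j, hj⟩ =>
      hN j i ((Finset.le_sup (Finset.mem_univ j)).trans hi) hj⟩

end Term

theorem liftSub_eq_var {σ : ℕ → Term L} {k : ℕ} (hσ : ∀ n < k, σ n = .var n) :
    ∀ n < k + 1, liftSub σ n = .var n
  | 0, _ => rfl
  | n + 1, h => by simp [liftSub, hσ n (by omega), Term.shiftUp]

theorem closedAt_liftSub {σ : ℕ → Term L} {k m : ℕ} (hσ : ∀ n < k, (σ n).ClosedAt m) :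
    ∀ n < k + 1, (liftSub σ n).ClosedAt (m + 1)
  | 0, _ => Nat.succ_pos m
  | n + 1, h => Term.closedAt_shiftUp.2 (hσ n (by omega))

theorem lt_of_closedAt_liftSub {σ : ℕ → Term L} {k m : ℕ}
    (hσ : ∀ n, (σ n).ClosedAt m → n < k) :
    ∀ n, (liftSub σ n).ClosedAt (m + 1) → n < k + 1
  | 0, _ => Nat.succ_pos k
  | n + 1, h => Nat.succ_lt_succ (hσ n (Term.closedAt_shiftUp.1 h))

namespace Formula

theorem applySub_eq_self {φ : Formula L} : ∀ {σ : ℕ → Term L} {k : ℕ},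
    (∀ n < k, σ n = .var n) → φ.ClosedAt k → φ.applySub σ = φ := by
  induction φ with
  | top => intros; rfl
  | bot => intros; rfl
  | rel R ts =>
    intro σ k hσ h
    exact congrArg _ (funext fun i => Term.applySub_eq_self hσ (h i))
  | and φ ψ ih₁ ih₂ => intro σ k hσ h; simp only [applySub, ih₁ hσ h.1, ih₂ hσ h.2]
  | or φ ψ ih₁ ih₂ => intro σ k hσ h; simp only [applySub, ih₁ hσ h.1, ih₂ hσ h.2]
  | imp φ ψ ih₁ ih₂ => intro σ k hσ h; simp only [applySub, ih₁ hσ h.1, ih₂ hσ h.2]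
  | all φ ih => intro σ k hσ h; exact congrArg _ (ih (liftSub_eq_var hσ) h)
  | ex φ ih => intro σ k hσ h; exact congrArg _ (ih (liftSub_eq_var hσ) h)

theorem ClosedAt.applySub {φ : Formula L} : ∀ {σ : ℕ → Term L} {k m : ℕ},
    (∀ n < k, (σ n).ClosedAt m) → φ.ClosedAt k → (φ.applySub σ).ClosedAt m := by
  induction φ with
  | top => intros; trivial
  | bot => intros; trivial
  | rel R ts => intro σ k m hσ h i; exact (h i).applySub hσ
  | and φ ψ ih₁ ih₂ => intro σ k m hσ h; exact ⟨ih₁ hσ h.1, ih₂ hσ h.2⟩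
  | or φ ψ ih₁ ih₂ => intro σ k m hσ h; exact ⟨ih₁ hσ h.1, ih₂ hσ h.2⟩
  | imp φ ψ ih₁ ih₂ => intro σ k m hσ h; exact ⟨ih₁ hσ h.1, ih₂ hσ h.2⟩
  | all φ ih => intro σ k m hσ h; exact ih (closedAt_liftSub hσ) h
  | ex φ ih => intro σ k m hσ h; exact ih (closedAt_liftSub hσ) h

theorem ClosedAt.of_applySub {φ : Formula L} : ∀ {σ : ℕ → Term L} {k m : ℕ},
    (∀ n, (σ n).ClosedAt m → n < k) → (φ.applySub σ).ClosedAt m → φ.ClosedAt k := by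
  induction φ with
  | top => intros; trivial
  | bot => intros; trivial
  | rel R ts => intro σ k m hσ h i; exact Term.ClosedAt.of_applySub hσ (h i)
  | and φ ψ ih₁ ih₂ => intro σ k m hσ h; exact ⟨ih₁ hσ h.1, ih₂ hσ h.2⟩
  | or φ ψ ih₁ ih₂ => intro σ k m hσ h; exact ⟨ih₁ hσ h.1, ih₂ hσ h.2⟩
  | imp φ ψ ih₁ ih₂ => intro σ k m hσ h; exact ⟨ih₁ hσ h.1, ih₂ hσ h.2⟩
  | all φ ih => intro σ k m hσ h; exact ih (lt_of_closedAt_liftSub hσ) h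
  | ex φ ih => intro σ k m hσ h; exact ih (lt_of_closedAt_liftSub hσ) h

theorem ClosedAt.mono {φ : Formula L} : ∀ {k m : ℕ}, k ≤ m → φ.ClosedAt k → φ.ClosedAt m := by
  intro k m hkm h
  have hvar : ∀ n < k, (Term.var n : Term L).ClosedAt m := fun n hn => hn.trans_le hkm
  simpa only [applySub_eq_self (fun n _ => rfl) h] using h.applySub hvar

theorem exists_fresh_bound (φ : Formula L.plus) :
    ∃ N : ℕ, ∀ i ≥ N, ¬ φ.OccC (Sum.inr i : L.plus.Const) := by
  induction φ with
  | top => exact ⟨0, fun _ _ h => h⟩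
  | bot => exact ⟨0, fun _ _ h => h⟩
  | rel R ts =>
    choose N hN using fun i => Term.exists_fresh_bound (ts i)
    exact ⟨Finset.univ.sup N, fun i hi ⟨j, hj⟩ =>
      hN j i ((Finset.le_sup (Finset.mem_univ j)).trans hi) hj⟩
  | and φ ψ ih₁ ih₂ | or φ ψ ih₁ ih₂ | imp φ ψ ih₁ ih₂ =>
    obtain ⟨N₁, h₁⟩ := ih₁
    obtain ⟨N₂, h₂⟩ := ih₂
    exact ⟨max N₁ N₂, fun i hi h => h.elim (h₁ i (le_of_max_le_left hi))
      (h₂ i (le_of_max_le_right hi))⟩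
  | all φ ih => exact ih
  | ex φ ih => exact ih

end Formula

theorem subst0_of_sentence {φ : Formula L} (h : φ.Sentence) (t : Term L) : subst0 φ t = φ :=
  Formula.applySub_eq_self (k := 0) (fun _ hn => absurd hn (Nat.not_lt_zero _)) h

theorem closed_aconst (i : ℕ) : (aconst L i).Closed := trivial

theorem sentence_subst0 {φ : Formula L} {t : Term L} (h : φ.ClosedAt 1) (ht : t.Closed) :
    (subst0 φ t).Sentence :=
  h.applySub fun n hn => by
    obtain rfl : n = 0 := by omega
    exact ht

theorem closedAt_of_sentence_subst0 {φ : Formula L} {t : Term L} (h : (subst0 φ t).Sentence) :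
    φ.ClosedAt 1 :=
  Formula.ClosedAt.of_applySub (fun n hn => by
    cases n with
    | zero => exact Nat.one_pos
    | succ n => exact absurd hn (Nat.not_lt_zero n)) h

theorem subst0_imp_of_sentence_left {φ ψ : Formula L} (h : φ.Sentence) (t : Term L) :
    subst0 (.imp φ ψ) t = .imp φ (subst0 ψ t) :=
  congrArg (fun χ => Formula.imp χ (subst0 ψ t)) (subst0_of_sentence h t)

theorem subst0_imp_of_sentence_right {φ ψ : Formula L} (h : ψ.Sentence) (t : Term L) :
    subst0 (.imp φ ψ) t = .imp (subst0 φ t) ψ :=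
  congrArg (Formula.imp (subst0 φ t)) (subst0_of_sentence h t)

theorem subst0_and_of_sentence_left {φ ψ : Formula L} (h : φ.Sentence) (t : Term L) :
    subst0 (.and φ ψ) t = .and φ (subst0 ψ t) :=
  congrArg (fun χ => Formula.and χ (subst0 ψ t)) (subst0_of_sentence h t)

theorem subst0_boxN (φ : Formula L) (t : Term L) :
    ∀ n, subst0 (boxN n φ) t = boxN n (subst0 φ t)
  | 0 => rfl
  | n + 1 => congrArg (Formula.imp .top) (subst0_boxN φ t n)

theorem closedAt_boxN {φ : Formula L} {k : ℕ} : ∀ {n}, (boxN n φ).ClosedAt k ↔ φ.ClosedAt k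
  | 0 => Iff.rfl
  | n + 1 => (and_iff_right trivial).trans (closedAt_boxN (n := n))

theorem occC_boxN {φ : Formula L} {c : L.Const} : ∀ {n}, (boxN n φ).OccC c ↔ φ.OccC c
  | 0 => Iff.rfl
  | n + 1 => (or_iff_right id).trans (occC_boxN (n := n))

theorem boxN_boxN (φ : Formula L) (m : ℕ) : ∀ n, boxN n (boxN m φ) = boxN (n + m) φ
  | 0 => by rw [Nat.zero_add]; rfl
  | n + 1 => by rw [Nat.succ_add]; exact congrArg (Formula.imp .top) (boxN_boxN φ m n)

namespace Prf

variable {Γ Δ Γ' Δ' : Set (Formula L.plus)} {φ ψ χ : Formula L.plus}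

theorem sentence (h : Prf L Γ Δ φ) : φ.Sentence := by
  induction h with
  | hyp _ hs => exact hs
  | weaken _ _ _ ih => exact ih
  | topIntro => trivial
  | botElim hs => exact hs
  | andIntro _ _ ih₁ ih₂ => exact ⟨ih₁, ih₂⟩
  | andElimL _ ih => exact ih.1
  | andElimR _ ih => exact ih.2
  | orIntroL hs _ ih => exact ⟨ih, hs⟩
  | orIntroR hs _ ih => exact ⟨hs, ih⟩
  | orElim _ _ _ _ ih _ => exact ih
  | impIntro hs _ ih => exact ⟨hs, ih⟩
  | impElim _ _ _ ih => exact ih.2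
  | intTrans _ _ ih₁ ih₂ => exact ⟨ih₁.1, ih₂.2⟩
  | intAndIntro _ _ ih₁ ih₂ => exact ⟨ih₁.1, ih₁.2, ih₂.2⟩
  | intOrElim _ _ ih₁ ih₂ => exact ⟨⟨ih₁.1, ih₂.1⟩, ih₁.2⟩
  | intAllIntro hs _ ih => exact ⟨hs, ih.2⟩
  | intExElim hs _ ih => exact ⟨ih.1, hs⟩
  | allIntro _ _ _ _ _ _ ih => exact closedAt_of_sentence_subst0 ih
  | allElim ht _ ih => exact sentence_subst0 ih ht
  | cd hs _ ih => exact ⟨hs, ih.2⟩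
  | exIntro _ hs => exact hs
  | exElim _ _ _ _ _ _ _ _ _ ih => exact ih

theorem assumption (h : φ ∈ Δ) (hs : φ.Sentence) : Prf L Γ Δ φ := hyp (Or.inr h) hs

theorem insert_self (hs : φ.Sentence) : Prf L Γ (insert φ Δ) φ :=
  assumption (Set.mem_insert _ _) hs

theorem weaken_insert (χ : Formula L.plus) (h : Prf L Γ Δ φ) : Prf L Γ (insert χ Δ) φ :=
  weaken subset_rfl (Set.subset_insert _ _) h

/-- Safely usable assumptions may be moved to the zone where unsafe use is allowed. -/
theorem move_assumptions (h : Prf L Γ Δ φ) :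
    ∀ {Γ' Δ' : Set (Formula L.plus)}, Γ ⊆ Γ' → Δ ⊆ Γ' ∪ Δ' → Prf L Γ' Δ' φ := by
  have key : ∀ {Δ Γ' Δ' : Set (Formula L.plus)} (χ), Δ ⊆ Γ' ∪ Δ' →
      insert χ Δ ⊆ Γ' ∪ insert χ Δ' := fun χ h => by
    rw [Set.union_insert]; exact Set.insert_subset_insert h
  have split : ∀ {Δ Δ₀ Γ' Δ' : Set (Formula L.plus)}, Δ₀ ⊆ Δ → Δ ⊆ Γ' ∪ Δ' →
      Δ₀ ⊆ Δ₀ ∩ Γ' ∪ Δ₀ ∩ Δ' := fun h₀ h x hx =>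
    (h (h₀ hx)).imp (fun h => ⟨hx, h⟩) fun h => ⟨hx, h⟩
  induction h with
  | hyp hm hs =>
    intro Γ' Δ' hΓ hΔ
    exact hyp (hm.elim (fun h => Or.inl (hΓ h)) fun h => hΔ h) hs
  | weaken h₁ h₂ _ ih => intro Γ' Δ' hΓ hΔ; exact ih (h₁.trans hΓ) (h₂.trans hΔ)
  | topIntro => intros; exact topIntro
  | botElim hs _ ih => intro Γ' Δ' hΓ hΔ; exact botElim hs (ih hΓ hΔ)
  | andIntro _ _ ih₁ ih₂ => intro Γ' Δ' hΓ hΔ; exact andIntro (ih₁ hΓ hΔ) (ih₂ hΓ hΔ)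
  | andElimL _ ih => intro Γ' Δ' hΓ hΔ; exact andElimL (ih hΓ hΔ)
  | andElimR _ ih => intro Γ' Δ' hΓ hΔ; exact andElimR (ih hΓ hΔ)
  | orIntroL hs _ ih => intro Γ' Δ' hΓ hΔ; exact orIntroL hs (ih hΓ hΔ)
  | orIntroR hs _ ih => intro Γ' Δ' hΓ hΔ; exact orIntroR hs (ih hΓ hΔ)
  | orElim _ _ _ ih₀ ih₁ ih₂ =>
    intro Γ' Δ' hΓ hΔ
    exact orElim (ih₀ hΓ hΔ) (ih₁ hΓ (key _ hΔ)) (ih₂ hΓ (key _ hΔ))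
  | impIntro hs _ ih => intro Γ' Δ' hΓ hΔ; exact impIntro hs (ih hΓ (key _ hΔ))
  | impElim _ _ ih₁ ih₂ =>
    intro Γ' Δ' hΓ hΔ
    exact impElim (ih₁ hΓ hΔ) (ih₂ hΓ (Set.empty_subset _))
  | intTrans _ _ ih₁ ih₂ => intro Γ' Δ' hΓ hΔ; exact intTrans (ih₁ hΓ hΔ) (ih₂ hΓ hΔ)
  | intAndIntro _ _ ih₁ ih₂ => intro Γ' Δ' hΓ hΔ; exact intAndIntro (ih₁ hΓ hΔ) (ih₂ hΓ hΔ)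
  | intOrElim _ _ ih₁ ih₂ => intro Γ' Δ' hΓ hΔ; exact intOrElim (ih₁ hΓ hΔ) (ih₂ hΓ hΔ)
  | intAllIntro hs _ ih => intro Γ' Δ' hΓ hΔ; exact intAllIntro hs (ih hΓ hΔ)
  | intExElim hs _ ih => intro Γ' Δ' hΓ hΔ; exact intExElim hs (ih hΓ hΔ)
  | @allIntro _ _ Γ₀ Δ₀ _ i h₁ h₂ f₁ f₂ hφ _ ih =>
    intro Γ' Δ' hΓ hΔ
    refine allIntro (Γ' := Γ₀ ∪ Δ₀ ∩ Γ') (Δ' := Δ₀ ∩ Δ')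
      (Set.union_subset (h₁.trans hΓ) Set.inter_subset_right) Set.inter_subset_right
      (fun x hx => hx.elim (f₁ x) fun h => f₂ x h.1) (fun x hx => f₂ x hx.1) hφ
      (ih Set.subset_union_left ?_)
    exact (split h₂ hΔ).trans (Set.union_subset_union_left _ Set.subset_union_right)
  | allElim ht _ ih => intro Γ' Δ' hΓ hΔ; exact allElim ht (ih hΓ hΔ)
  | cd hs _ ih => intro Γ' Δ' hΓ hΔ; exact cd hs (ih hΓ hΔ)
  | exIntro ht hs _ ih => intro Γ' Δ' hΓ hΔ; exact exIntro ht hs (ih hΓ hΔ)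
  | @exElim _ _ Γ₀ Δ₀ _ _ i h₁ h₂ f₁ f₂ hφ hψ _ _ ih₁ ih₂ =>
    intro Γ' Δ' hΓ hΔ
    refine exElim (Γ' := Γ₀ ∪ Δ₀ ∩ Γ') (Δ' := Δ₀ ∩ Δ')
      (Set.union_subset (h₁.trans hΓ) Set.inter_subset_right) Set.inter_subset_right
      (fun x hx => hx.elim (f₁ x) fun h => f₂ x h.1) (fun x hx => f₂ x hx.1) hφ hψ (ih₁ hΓ hΔ)
      (ih₂ Set.subset_union_left (key _ ?_))
    exact (split h₂ hΔ).trans (Set.union_subset_union_left _ Set.subset_union_right)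

theorem of_boxN (h : Prf L Γ ∅ (boxN n φ)) : Prf L Γ ∅ φ := by
  induction n with
  | zero => exact h
  | succ n ih => exact ih (impElim topIntro h)

theorem boxN_mono {n m : ℕ} (hnm : n ≤ m) (h : Prf L Γ Δ (boxN n φ)) :
    Prf L Γ Δ (boxN m φ) := by
  induction m, hnm using Nat.le_induction with
  | base => exact h
  | succ m _ ih => exact impIntro trivial (ih.weaken_insert _)

theorem boxN_imp_boxN (h : Prf L Γ Δ (.imp φ ψ)) :
    ∀ n, Prf L Γ Δ (.imp (boxN n φ) (boxN n ψ))
  | 0 => h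
  | n + 1 =>
    have hs : (boxN (n + 1) φ).Sentence := closedAt_boxN.2 h.sentence.1
    impIntro hs (intTrans (insert_self hs) ((boxN_imp_boxN h n).weaken_insert _))

theorem boxN_and : ∀ {n : ℕ} {Δ : Set (Formula L.plus)}, Prf L Γ Δ (boxN n φ) →
    Prf L Γ Δ (boxN n ψ) → Prf L Γ Δ (boxN n (.and φ ψ))
  | 0, _, h₁, h₂ => andIntro h₁ h₂
  | n + 1, _, h₁, h₂ =>
    have hs : (Formula.and (boxN n φ) (boxN n ψ)).Sentence := ⟨h₁.sentence.2, h₂.sentence.2⟩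
    intTrans (intAndIntro h₁ h₂) (impIntro hs
      (boxN_and (andElimL (insert_self hs)) (andElimR (insert_self hs))))

theorem boxN_all : ∀ {n : ℕ} {Δ : Set (Formula L.plus)}, Prf L Γ Δ (.all (boxN n φ)) →
    Prf L Γ Δ (boxN n (.all φ))
  | 0, _, h => h
  | n + 1, _, h =>
    have hs : (Formula.all (boxN n φ)).Sentence := h.sentence.2
    intTrans (intAllIntro trivial h) (impIntro hs (boxN_all (insert_self hs)))

end Prf

/-- All axioms of `TJK^{d+}` are provable without unsafe assumptions. -/
theorem TJKAx.prf {φ : Formula L.plus} (h : TJKAx L φ) : Prf L ∅ ∅ φ := by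
  open Prf in
  cases h with
  | id h => exact impIntro h (insert_self h)
  | toTop h => exact impIntro h topIntro
  | fromBot h => exact impIntro trivial (botElim h (insert_self trivial))
  | andComp h₁ h₂ h₃ =>
    have hs := insert_self (Γ := ∅) (Δ := ∅) (L := L)
      (φ := .and (.imp _ _) (.imp _ _)) ⟨⟨h₃, h₁⟩, h₃, h₂⟩
    exact impIntro hs.sentence (intAndIntro (.andElimL hs) (.andElimR hs))
  | andElimL h₁ h₂ => exact impIntro ⟨h₁, h₂⟩ (.andElimL (insert_self ⟨h₁, h₂⟩))
  | andElimR h₁ h₂ => exact impIntro ⟨h₁, h₂⟩ (.andElimR (insert_self ⟨h₁, h₂⟩))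
  | orIntroL h₁ h₂ => exact impIntro h₁ (.orIntroL h₂ (insert_self h₁))
  | orIntroR h₁ h₂ => exact impIntro h₂ (.orIntroR h₁ (insert_self h₂))
  | orComp h₁ h₂ h₃ =>
    have hs := insert_self (Γ := ∅) (Δ := ∅) (L := L)
      (φ := .and (.imp _ _) (.imp _ _)) ⟨⟨h₁, h₃⟩, h₂, h₃⟩
    exact impIntro hs.sentence (intOrElim (.andElimL hs) (.andElimR hs))
  | distrib h₁ h₂ h₃ =>
    have hs := insert_self (Γ := ∅) (Δ := ∅) (L := L)
      (φ := .and _ (.or _ _)) ⟨h₁, h₂, h₃⟩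
    exact impIntro hs.sentence (orElim (.andElimR hs)
      (.orIntroL ⟨h₁, h₃⟩ (andIntro (.andElimL (hs.weaken_insert _)) (insert_self h₂)))
      (.orIntroR ⟨h₁, h₂⟩ (andIntro (.andElimL (hs.weaken_insert _)) (insert_self h₃))))
  | allImp h₁ h₂ =>
    have hs := insert_self (Γ := ∅) (Δ := ∅) (L := L)
      (φ := .all (.imp _ _)) ⟨h₁.mono (Nat.zero_le 1), h₂⟩
    exact impIntro hs.sentence (intAllIntro h₁ hs)
  | @allElim φ t h₁ ht =>
    exact impIntro (φ := .all φ) h₁ (.allElim ht (insert_self (φ := .all φ) h₁))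
  | @exIntro φ t h₁ ht =>
    have hs := sentence_subst0 h₁ ht
    exact impIntro hs (.exIntro ht h₁ (insert_self hs))
  | exImp h₁ h₂ =>
    have hs := insert_self (Γ := ∅) (Δ := ∅) (L := L)
      (φ := .all (.imp _ _)) ⟨h₁, h₂.mono (Nat.zero_le 1)⟩
    exact impIntro hs.sentence (intExElim h₂ hs)
  | cd h₁ h₂ =>
    have hs := insert_self (Γ := ∅) (Δ := ∅) (L := L)
      (φ := .all (.or _ _)) ⟨h₁.mono (Nat.zero_le 1), h₂⟩
    exact impIntro hs.sentence (.cd h₁ hs)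
  | @exDistrib φ ψ h₁ h₂ =>
    have hs := insert_self (Γ := ∅) (Δ := ∅) (L := L) (φ := .and φ (.ex ψ)) ⟨h₁, h₂⟩
    obtain ⟨i, hi⟩ := (Formula.and φ ψ).exists_fresh_bound
    have hi := hi i le_rfl
    have hψ : (subst0 ψ (aconst L i)).Sentence := sentence_subst0 h₂ (closed_aconst i)
    refine impIntro hs.sentence (exElim (i := i) subset_rfl subset_rfl (fun _ h => h.elim)
      (fun x hx => ?_) (fun h => hi (.inr h)) hi (.andElimR hs)
      (.exIntro (closed_aconst i) ⟨h₁.mono (Nat.zero_le 1), h₂⟩ ?_))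
    · obtain rfl : x = .and φ (.ex ψ) := by simpa using hx
      exact hi
    · rw [subst0_and_of_sentence_left h₁]
      exact andIntro (.andElimL (hs.weaken_insert _)) (insert_self hψ)
  | trans h₁ h₂ h₃ =>
    have hs := insert_self (Γ := ∅) (Δ := ∅) (L := L)
      (φ := .and (.imp _ _) (.imp _ _)) ⟨⟨h₁, h₂⟩, h₂, h₃⟩
    exact impIntro hs.sentence (intTrans (.andElimL hs) (.andElimR hs))
  | weakK h₁ h₂ => exact impIntro h₁ (impIntro h₂ ((insert_self h₁).weaken_insert _))
  | @prefixing φ ψ χ h₁ h₂ h₃ =>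
    have h₁₂ : (Formula.imp φ ψ).Sentence := ⟨h₁, h₂⟩
    have h₃₁ : (Formula.imp χ φ).Sentence := ⟨h₃, h₁⟩
    exact impIntro h₁₂ (impIntro h₃₁ (intTrans (insert_self h₃₁) ((insert_self h₁₂).weaken_insert _)))
  | @suffixing φ ψ χ h₁ h₂ h₃ =>
    have h₁₂ : (Formula.imp φ ψ).Sentence := ⟨h₁, h₂⟩
    have h₂₃ : (Formula.imp ψ χ).Sentence := ⟨h₂, h₃⟩
    exact impIntro h₁₂ (impIntro h₂₃ (intTrans ((insert_self h₁₂).weaken_insert _) (insert_self h₂₃)))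

/-- Some iterated box `□ⁿφ` is provable from `Γ` with all assumptions used safely. -/
def BoxPrv (L : Signature) (Γ : Set (Formula L.plus)) (φ : Formula L.plus) : Prop :=
  ∃ n, Prf L ∅ Γ (boxN n φ)

namespace BoxPrv

variable {Γ Γ' : Set (Formula L.plus)} {φ ψ : Formula L.plus}

theorem of_prf (h : Prf L ∅ Γ φ) : BoxPrv L Γ φ := ⟨0, h⟩

theorem mono (hΓ : Γ ⊆ Γ') : BoxPrv L Γ φ → BoxPrv L Γ' φ
  | ⟨n, h⟩ => ⟨n, .weaken subset_rfl hΓ h⟩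

theorem sentence : BoxPrv L Γ φ → φ.Sentence
  | ⟨_, h⟩ => closedAt_boxN.1 h.sentence

theorem unbox {m : ℕ} : BoxPrv L Γ (boxN m φ) → BoxPrv L Γ φ
  | ⟨n, h⟩ => ⟨n + m, boxN_boxN φ m n ▸ h⟩

theorem mp (h : Prf L ∅ Γ (.imp φ ψ)) : BoxPrv L Γ φ → BoxPrv L Γ ψ
  | ⟨n, h'⟩ => ⟨n + 1, .intTrans (h'.boxN_mono n.le_succ) (h.boxN_imp_boxN n)⟩

theorem map (h : Prf L ∅ {φ} ψ) (h' : BoxPrv L Γ φ) : BoxPrv L Γ ψ :=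
  h'.mp (.impIntro h'.sentence (.weaken subset_rfl (by simp) h))

theorem and : BoxPrv L Γ φ → BoxPrv L Γ ψ → BoxPrv L Γ (.and φ ψ)
  | ⟨n, h₁⟩, ⟨m, h₂⟩ =>
    ⟨max n m, .boxN_and (h₁.boxN_mono (le_max_left n m)) (h₂.boxN_mono (le_max_right n m))⟩

end BoxPrv

theorem TJKd.boxPrv {Γ : Set (Formula L.plus)} {φ : Formula L.plus} (h : TJKd L Γ φ) :
    BoxPrv L Γ φ := by
  have self : ∀ {φ : Formula L.plus}, φ.Sentence → Prf L ∅ {φ} φ :=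
    fun hs => .assumption rfl hs
  induction h with
  | hyp hm hs => exact .of_prf (.assumption hm hs)
  | weaken hΓ _ ih => exact ih.mono hΓ
  | ax h => exact .of_prf (.weaken subset_rfl (Set.empty_subset _) h.prf)
  | topIntro => exact .of_prf .topIntro
  | botElim hs _ ih => exact ih.map (.botElim hs (self trivial))
  | andIntro _ _ ih₁ ih₂ => exact ih₁.and ih₂
  | andElimL _ ih => exact ih.map (.andElimL (self ih.sentence))
  | andElimR _ ih => exact ih.map (.andElimR (self ih.sentence))
  | orIntroL hs _ ih => exact ih.map (.orIntroL hs (self ih.sentence))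
  | orIntroR hs _ ih => exact ih.map (.orIntroR hs (self ih.sentence))
  | orElim _ _ _ ih₀ ih₁ ih₂ =>
    obtain ⟨n, h₁⟩ := ih₁
    obtain ⟨m, h₂⟩ := ih₂
    exact (ih₀.mp (.intOrElim
      (.impIntro ih₀.sentence.1 (h₁.boxN_mono (le_max_left n m)))
      (.impIntro ih₀.sentence.2 (h₂.boxN_mono (le_max_right n m))))).unbox
  | impElim _ _ ih₁ ih₂ =>
    have hs := self (ih₁.and ih₂).sentence
    exact ((ih₁.and ih₂).map (ψ := boxN 1 _)
      (.intTrans (.impIntro trivial (.weaken_insert _ (.andElimL hs))) (.andElimR hs))).unbox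
  | affix _ _ ih₁ ih₂ =>
    have hs := self (ih₁.and ih₂).sentence
    have hm := (⟨ih₁.sentence.2, ih₂.sentence.1⟩ : Formula.Sentence (.imp _ _))
    exact (ih₁.and ih₂).map (.impIntro hm
      (.intTrans (.intTrans (.weaken_insert _ (.andElimL hs)) (.insert_self hm))
        (.weaken_insert _ (.andElimR hs))))
  | allIntro hΓ hf hφ _ ih =>
    obtain ⟨n, h⟩ := ih
    rw [← subst0_boxN] at h
    exact ⟨n, .boxN_all (.allIntro subset_rfl hΓ (fun _ h => h.elim) hf
      (fun h => hφ (occC_boxN.1 h)) h)⟩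
  | allElim ht _ ih => exact ih.map (.allElim ht (self ih.sentence))
  | cd hs _ ih => exact ih.map (.cd hs (self ih.sentence))
  | exIntro ht hs _ ih => exact ih.map (.exIntro ht hs (self ih.sentence))
  | exElim hΓ hf hφ hψ _ _ ih₁ ih₂ =>
    have hs := ih₂.sentence
    obtain ⟨n, h⟩ := ih₂
    have hs' := (closedAt_boxN (n := n)).2 hs
    have h := Prf.impIntro (sentence_subst0 ih₁.sentence (closed_aconst _)) h
    rw [← subst0_imp_of_sentence_right hs'] at h
    exact (ih₁.mp (.intExElim hs' (.allIntro subset_rfl hΓ (fun _ h => h.elim) hf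
      (fun h => h.elim hφ fun h => hψ (occC_boxN.1 h)) h))).unbox

/-- Finite conjunctions of sentences from `Δ`. -/
inductive ConjOf (Δ : Set (Formula L)) : Formula L → Prop
  | top : ConjOf Δ .top
  | mem {φ} : φ ∈ Δ → φ.Sentence → ConjOf Δ φ
  | and {φ ψ} : ConjOf Δ φ → ConjOf Δ ψ → ConjOf Δ (.and φ ψ)

namespace ConjOf

variable {Δ Δ' : Set (Formula L)} {C : Formula L}

theorem sentence (h : ConjOf Δ C) : C.Sentence := by
  induction h with
  | top => trivial
  | mem _ hs => exact hs
  | and _ _ ih₁ ih₂ => exact ⟨ih₁, ih₂⟩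

theorem mono (hΔ : Δ ⊆ Δ') (h : ConjOf Δ C) : ConjOf Δ' C := by
  induction h with
  | top => exact top
  | mem hm hs => exact mem (hΔ hm) hs
  | and _ _ ih₁ ih₂ => exact ih₁.and ih₂

theorem not_occC {Δ : Set (Formula L.plus)} {C : Formula L.plus} {i : ℕ} (hf : FreshIn i Δ)
    (h : ConjOf Δ C) : ¬ C.OccC (Sum.inr i : L.plus.Const) := by
  induction h with
  | top => exact fun h => h
  | mem hm _ => exact hf _ hm
  | and _ _ ih₁ ih₂ => exact fun h => h.elim ih₁ ih₂

end ConjOf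

namespace TJKd

variable {Γ : Set (Formula L.plus)} {φ ψ χ : Formula L.plus}

theorem sentence (h : TJKd L Γ φ) : φ.Sentence := h.boxPrv.sentence

theorem imp_trans (h₁ : TJKd L Γ (.imp φ ψ)) (h₂ : TJKd L Γ (.imp ψ χ)) :
    TJKd L Γ (.imp φ χ) :=
  impElim (andIntro h₁ h₂) (ax (.trans h₁.sentence.1 h₁.sentence.2 h₂.sentence.2))

theorem imp_and (h₁ : TJKd L Γ (.imp χ φ)) (h₂ : TJKd L Γ (.imp χ ψ)) :
    TJKd L Γ (.imp χ (.and φ ψ)) :=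
  impElim (andIntro h₁ h₂) (ax (.andComp h₁.sentence.2 h₂.sentence.2 h₁.sentence.1))

theorem or_imp (h₁ : TJKd L Γ (.imp φ χ)) (h₂ : TJKd L Γ (.imp ψ χ)) :
    TJKd L Γ (.imp (.or φ ψ) χ) :=
  impElim (andIntro h₁ h₂) (ax (.orComp h₁.sentence.1 h₂.sentence.1 h₁.sentence.2))

theorem imp_of (hs : ψ.Sentence) (h : TJKd L Γ φ) : TJKd L Γ (.imp ψ φ) :=
  impElim h (ax (.weakK h.sentence hs))

theorem and_imp_left (hψ : ψ.Sentence) (h : TJKd L Γ (.imp φ χ)) :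
    TJKd L Γ (.imp (.and φ ψ) χ) :=
  imp_trans (ax (.andElimL h.sentence.1 hψ)) h

theorem and_imp_right (hφ : φ.Sentence) (h : TJKd L Γ (.imp ψ χ)) :
    TJKd L Γ (.imp (.and φ ψ) χ) :=
  imp_trans (ax (.andElimR hφ h.sentence.1)) h

theorem curry (h : TJKd L Γ (.imp (.and φ ψ) χ)) : TJKd L Γ (.imp φ (.imp ψ χ)) := by
  have hs := h.sentence
  have h₁ : TJKd L Γ (.imp φ (.imp ψ (.and φ ψ))) :=
    imp_trans (imp_and (ax (.weakK hs.1.1 hs.1.2)) (imp_of hs.1.1 (ax (.id hs.1.2))))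
      (ax (.andComp hs.1.1 hs.1.2 hs.1.2))
  exact imp_trans h₁ (impElim h (ax (.prefixing hs.1 hs.2 hs.1.2)))

theorem all_imp (hs : φ.Sentence) (h : TJKd L Γ (.all (.imp φ ψ))) :
    TJKd L Γ (.imp φ (.all ψ)) :=
  impElim h (ax (.allImp hs h.sentence.2))

theorem ex_imp (hs : ψ.Sentence) (h : TJKd L Γ (.all (.imp φ ψ))) :
    TJKd L Γ (.imp (.ex φ) ψ) :=
  impElim h (ax (.exImp h.sentence.1 hs))

end TJKd

theorem ConjOf.of_insert (Γ : Set (Formula L.plus)) {Δ : Set (Formula L.plus)}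
    {φ C : Formula L.plus} (hφ : φ.Sentence) (h : ConjOf (insert φ Δ) C) :
    ∃ D, ConjOf Δ D ∧ TJKd L Γ (.imp (.and D φ) C) := by
  induction h with
  | top => exact ⟨.top, .top, .ax (.toTop ⟨trivial, hφ⟩)⟩
  | @mem ψ hm hs =>
    rcases hm with rfl | hm
    · exact ⟨.top, .top, .ax (.andElimR trivial hφ)⟩
    · exact ⟨ψ, .mem hm hs, .ax (.andElimL hs hφ)⟩
  | and _ _ ih₁ ih₂ =>
    obtain ⟨D₁, hD₁, h₁⟩ := ih₁
    obtain ⟨D₂, hD₂, h₂⟩ := ih₂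
    have s₁ := hD₁.sentence
    have s₂ := hD₂.sentence
    have s : (Formula.and D₁ D₂).Sentence := ⟨s₁, s₂⟩
    have hr : TJKd L Γ (.imp (.and (.and D₁ D₂) φ) φ) := .ax (.andElimR s hφ)
    exact ⟨.and D₁ D₂, hD₁.and hD₂, .imp_and
      (.imp_trans (.imp_and (.and_imp_left hφ (.ax (.andElimL s₁ s₂))) hr) h₁)
      (.imp_trans (.imp_and (.and_imp_left hφ (.ax (.andElimR s₁ s₂))) hr) h₂)⟩

/-- Some finite conjunction of members of `Δ` provably implies `φ` in `TJK^{d+}` from `Γ`. -/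
def ImpPrv (L : Signature) (Γ Δ : Set (Formula L.plus)) (φ : Formula L.plus) : Prop :=
  ∃ C, ConjOf Δ C ∧ TJKd L Γ (.imp C φ)

namespace ImpPrv

variable {Γ Γ' Δ Δ' : Set (Formula L.plus)} {φ ψ χ : Formula L.plus}

theorem of_tjkd (h : TJKd L Γ φ) : ImpPrv L Γ Δ φ := ⟨.top, .top, h.imp_of trivial⟩

theorem of_conjOf (h : ConjOf Δ φ) : ImpPrv L Γ Δ φ := ⟨φ, h, .ax (.id h.sentence)⟩

theorem sentence : ImpPrv L Γ Δ φ → φ.Sentence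
  | ⟨_, _, h⟩ => h.sentence.2

theorem mono (hΓ : Γ ⊆ Γ') (hΔ : Δ ⊆ Δ') : ImpPrv L Γ Δ φ → ImpPrv L Γ' Δ' φ
  | ⟨C, hC, h⟩ => ⟨C, hC.mono hΔ, h.weaken hΓ⟩

theorem map (h' : ImpPrv L Γ Δ φ) (h : TJKd L Γ (.imp φ ψ)) : ImpPrv L Γ Δ ψ :=
  let ⟨C, hC, hφ⟩ := h'
  ⟨C, hC, hφ.imp_trans h⟩

theorem and : ImpPrv L Γ Δ φ → ImpPrv L Γ Δ ψ → ImpPrv L Γ Δ (.and φ ψ)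
  | ⟨_, hC, h₁⟩, ⟨_, hD, h₂⟩ =>
    ⟨_, hC.and hD, .imp_and (.and_imp_left hD.sentence h₁) (.and_imp_right hC.sentence h₂)⟩

/-- An additional assumption may be split off the conjunction. -/
theorem of_insert (hφ : φ.Sentence) : ImpPrv L Γ (insert φ Δ) ψ →
    ∃ D, ConjOf Δ D ∧ TJKd L Γ (.imp (.and D φ) ψ)
  | ⟨_, hC, h⟩ =>
    let ⟨D, hD, h'⟩ := hC.of_insert Γ hφ
    ⟨D, hD, h'.imp_trans h⟩

theorem imp (hφ : φ.Sentence) (h : ImpPrv L Γ (insert φ Δ) ψ) : ImpPrv L Γ Δ (.imp φ ψ) :=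
  let ⟨D, hD, h'⟩ := h.of_insert hφ
  ⟨D, hD, h'.curry⟩

theorem or_elim (h : ImpPrv L Γ Δ (.or φ ψ)) (h₁ : ImpPrv L Γ (insert φ Δ) χ)
    (h₂ : ImpPrv L Γ (insert ψ Δ) χ) : ImpPrv L Γ Δ χ := by
  have hs := h.sentence
  obtain ⟨C, hC, h₁⟩ := h₁.of_insert hs.1
  obtain ⟨D, hD, h₂⟩ := h₂.of_insert hs.2
  have sC := hC.sentence
  have sD := hD.sentence
  have sCD : (Formula.and C D).Sentence := ⟨sC, sD⟩
  have hCD : ImpPrv L Γ Δ (.and C D) := of_conjOf (hC.and hD)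
  refine ((hCD.and h).map (.ax (.distrib sCD hs.1 hs.2))).map (.or_imp ?_ ?_)
  · exact .imp_trans (.imp_and (.and_imp_left hs.1 (.ax (.andElimL sC sD)))
      (.ax (.andElimR sCD hs.1))) h₁
  · exact .imp_trans (.imp_and (.and_imp_left hs.2 (.ax (.andElimR sC sD)))
      (.ax (.andElimR sCD hs.2))) h₂

theorem tjkd : ImpPrv L Γ ∅ φ → TJKd L Γ φ
  | ⟨_, hC, h⟩ => by
    have hC' : ∀ {C : Formula L.plus}, ConjOf ∅ C → TJKd L Γ C := fun hC => by
      induction hC with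
      | top => exact .topIntro
      | mem hm => exact hm.elim
      | and _ _ ih₁ ih₂ => exact ih₁.andIntro ih₂
    exact (hC' hC).impElim h

end ImpPrv

theorem Prf.impPrv {Γ Δ : Set (Formula L.plus)} {φ : Formula L.plus} (h : Prf L Γ Δ φ) :
    ImpPrv L Γ Δ φ := by
  induction h with
  | hyp hm hs =>
    rcases hm with hm | hm
    · exact .of_tjkd (.hyp hm hs)
    · exact ⟨_, .mem hm hs, .ax (.id hs)⟩
  | weaken hΓ hΔ _ ih => exact ih.mono hΓ hΔ
  | topIntro => exact .of_tjkd .topIntro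
  | botElim hs _ ih => exact ih.map (.ax (.fromBot hs))
  | andIntro _ _ ih₁ ih₂ => exact ih₁.and ih₂
  | andElimL _ ih => exact ih.map (.ax (.andElimL ih.sentence.1 ih.sentence.2))
  | andElimR _ ih => exact ih.map (.ax (.andElimR ih.sentence.1 ih.sentence.2))
  | orIntroL hs _ ih => exact ih.map (.ax (.orIntroL ih.sentence hs))
  | orIntroR hs _ ih => exact ih.map (.ax (.orIntroR hs ih.sentence))
  | orElim _ _ _ ih₀ ih₁ ih₂ => exact ih₀.or_elim ih₁ ih₂
  | impIntro hs _ ih => exact ih.imp hs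
  | impElim _ _ ih₁ ih₂ => exact ih₁.map ih₂.tjkd
  | intTrans _ _ ih₁ ih₂ =>
    exact (ih₁.and ih₂).map (.ax (.trans ih₁.sentence.1 ih₁.sentence.2 ih₂.sentence.2))
  | intAndIntro _ _ ih₁ ih₂ =>
    exact (ih₁.and ih₂).map (.ax (.andComp ih₁.sentence.2 ih₂.sentence.2 ih₁.sentence.1))
  | intOrElim _ _ ih₁ ih₂ =>
    exact (ih₁.and ih₂).map (.ax (.orComp ih₁.sentence.1 ih₂.sentence.1 ih₁.sentence.2))
  | intAllIntro hs _ ih => exact ih.map (.ax (.allImp hs ih.sentence.2))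
  | intExElim hs _ ih => exact ih.map (.ax (.exImp ih.sentence.1 hs))
  | allIntro hΓ hΔ fΓ fΔ hφ _ ih =>
    obtain ⟨C, hC, h⟩ := ih
    rw [← subst0_imp_of_sentence_left hC.sentence] at h
    exact ⟨C, hC.mono hΔ, .all_imp hC.sentence
      (.allIntro hΓ fΓ (fun h => h.elim (hC.not_occC fΔ) hφ) h)⟩
  | allElim ht _ ih => exact ih.map (.ax (.allElim ih.sentence ht))
  | cd hs _ ih => exact ih.map (.ax (.cd hs ih.sentence.2))
  | exIntro ht hs _ ih => exact ih.map (.ax (.exIntro hs ht))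
  | exElim hΓ hΔ fΓ fΔ hφ hψ _ _ ih₁ ih₂ =>
    have hs := ih₁.sentence
    have hsψ := ih₂.sentence
    obtain ⟨C, hC, h⟩ := ih₂.of_insert (sentence_subst0 hs (closed_aconst _))
    have sC := hC.sentence
    rw [← subst0_and_of_sentence_left sC, ← subst0_imp_of_sentence_right hsψ] at h
    exact (((ImpPrv.of_conjOf (hC.mono hΔ)).and ih₁).map (.ax (.exDistrib sC hs))).map (.ex_imp hsψ
      (.allIntro hΓ fΓ (fun h => h.elim (fun h => h.elim (hC.not_occC fΔ) hφ) hψ) h))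

end BQL

namespace BQL

/-- **Theorem 9**: `Γ ⊢ φ` (in the simplified natural deduction system `NBQL_CD^r`)
iff `Γ ⊢_{TJK^{d+}} φ` (in the original axiomatization of `TJK^{d+}`). -/
theorem nbql_eq_tjkd {L : Signature} (Γ : Set (Formula L.plus)) (φ : Formula L.plus)
    (hΓ : ∀ ψ ∈ Γ, Formula.Sentence ψ) (hφ : φ.Sentence) :
    Prv L Γ φ ↔ TJKd L Γ φ := by
  refine ⟨fun h => h.impPrv.tjkd, fun h => ?_⟩
  obtain ⟨n, h⟩ := h.boxPrv
  exact (h.move_assumptions (Set.empty_subset Γ) Set.subset_union_left).of_boxN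

end BQL
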